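/- arXiv:1103.2059 — 2 statements merged into one kernel-verified Lean document; each statement's English description precedes it below -/
import Mathlib

section
/- Let A be an n×n real symmetric matrix (n > 1) with nonnegative entries that is irreducible, ρ its Perron root, and p a strictly positive eigenvector with A p = ρ p. For an index j, let Ȳ(j) be the n×n matrix whose (k,l) entry equals ((ρI − A_ĵĵ)^{-1})_{kl} when k ≠ j and l ≠ j, and equals 0 when k = j or l = j; let Ȳ(j)^i denote the i-th column of Ȳ(j). Then for all indices i ≠ j, (ρI − A) · ( p_j · Ȳ(j)^i + p_i · Ȳ(i)^j ) = 0; consequently, if ker(ρI − A) = span{p}, the vector p_j · Ȳ(j)^i + p_i · Ȳ(i)^j is a scalar multiple of p. -/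
open Matrix

/-- The principal submatrix of `M` with row `j` and column `j` deleted. -/
noncomputable def delSub {n : ℕ} (M : Matrix (Fin n) (Fin n) ℝ) (j : Fin n) :
    Matrix {i : Fin n // i ≠ j} {i : Fin n // i ≠ j} ℝ :=
  M.submatrix Subtype.val Subtype.val

/-- `Ȳ(j)`: the matrix `(ρI - A_ĵĵ)⁻¹` supplemented by a zero row `j` and zero column `j`. -/
noncomputable def Ybar {n : ℕ} (A : Matrix (Fin n) (Fin n) ℝ) (ρ : ℝ) (j : Fin n) :
    Matrix (Fin n) (Fin n) ℝ :=
  Matrix.of fun k l =>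
    if hk : k = j then 0
    else if hl : l = j then 0
    else ((ρ • (1 : Matrix {i : Fin n // i ≠ j} {i : Fin n // i ≠ j} ℝ)
      - delSub A j)⁻¹) ⟨k, hk⟩ ⟨l, hl⟩

lemma dot_L {n : ℕ} (A : Matrix (Fin n) (Fin n) ℝ)
    (hsym : A.IsSymm) (ρ : ℝ) (p : Fin n → ℝ) (hAp : A.mulVec p = ρ • p) (y : Fin n → ℝ) :
    p ⬝ᵥ (A.mulVec y) = ρ * (p ⬝ᵥ y) := by
  rw [dotProduct_mulVec, ← mulVec_transpose, hsym.eq, hAp, smul_dotProduct, smul_eq_mul]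

lemma pow_nonneg_entries {n : ℕ} (A : Matrix (Fin n) (Fin n) ℝ) (hA : ∀ i j, 0 ≤ A i j) (k : ℕ) :
    ∀ i j, 0 ≤ (A ^ k) i j := by
  induction k with
  | zero => intro i j; rw [pow_zero, one_apply]; split_ifs <;> norm_num
  | succ k ih =>
    intro i j
    rw [pow_succ, mul_apply]
    exact Finset.sum_nonneg fun l _ => mul_nonneg (ih i l) (hA l j)

lemma zero_of_ker {n : ℕ} (A : Matrix (Fin n) (Fin n) ℝ)
    (hsym : A.IsSymm) (hA : ∀ i j, 0 ≤ A i j)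
    (hirr : ∀ i j : Fin n, i ≠ j → ∃ k : ℕ, 1 ≤ k ∧ 0 < (A ^ k) i j)
    (ρ : ℝ) (hρ : 0 < ρ) (p : Fin n → ℝ) (hp : ∀ i, 0 < p i)
    (hAp : A.mulVec p = ρ • p) (j : Fin n) (w : Fin n → ℝ) (hwj : w j = 0)
    (hw : ∀ k, k ≠ j → A.mulVec w k = ρ * w k) : w = 0 := by
  set u : Fin n → ℝ := fun k => |w k| with hu
  have hge : ∀ k, 0 ≤ A.mulVec u k - ρ * u k := by
    intro k
    by_cases hk : k = j
    · subst hk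
      simp only [hu, hwj, abs_zero, mul_zero, sub_zero, mulVec, dotProduct]
      exact Finset.sum_nonneg fun l _ => mul_nonneg (hA _ l) (abs_nonneg _)
    · have h1 : ρ * u k = |A.mulVec w k| := by
        rw [hw k hk, abs_mul, abs_of_pos hρ]
      rw [h1, sub_nonneg]
      simp only [mulVec, dotProduct]
      refine (Finset.abs_sum_le_sum_abs _ _).trans (le_of_eq ?_)
      refine Finset.sum_congr rfl fun l _ => ?_
      rw [abs_mul, abs_of_nonneg (hA k l)]
  have hsum : ∑ k, p k * (A.mulVec u k - ρ * u k) = 0 := by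
    have := dot_L A hsym ρ p hAp u
    simp only [dotProduct] at this
    simp only [mul_sub, Finset.sum_sub_distrib]
    rw [this, Finset.mul_sum, sub_eq_zero]
    exact Finset.sum_congr rfl fun l _ => by ring
  have hAu : A.mulVec u = ρ • u := by
    ext k
    have := (Finset.sum_eq_zero_iff_of_nonneg
      (fun k _ => mul_nonneg (hp k).le (hge k))).1 hsum k (Finset.mem_univ _)
    have := (mul_eq_zero.1 this).resolve_left (hp k).ne'
    simp only [Pi.smul_apply, smul_eq_mul]
    linarith
  have hpow : ∀ k : ℕ, (A ^ k).mulVec u = ρ ^ k • u := by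
    intro k
    induction k with
    | zero => simp
    | succ k ih => rw [pow_succ, ← mulVec_mulVec, hAu, mulVec_smul, ih, smul_smul, pow_succ, mul_comm]
  ext l
  by_cases hl : l = j
  · rw [hl, hwj]; rfl
  obtain ⟨k, _, hk⟩ := hirr j l (Ne.symm hl)
  have h0 : ∑ m, (A ^ k) j m * u m = 0 := by
    have := congrFun (hpow k) j
    simpa [hu, hwj, mulVec, dotProduct] using this
  have := (Finset.sum_eq_zero_iff_of_nonneg
    (fun m _ => mul_nonneg (pow_nonneg_entries A hA k j m) (abs_nonneg (w m)))).1 h0 l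
      (Finset.mem_univ _)
  exact abs_eq_zero.1 ((mul_eq_zero.1 this).resolve_left hk.ne')

lemma sum_split {n : ℕ} (j : Fin n) (f : Fin n → ℝ) (hf : f j = 0) :
    ∑ l, f l = ∑ l : {i : Fin n // i ≠ j}, f l.1 := by
  rw [← Finset.sum_subtype (Finset.univ.erase j) (by simp) f, Finset.sum_erase _ hf]

lemma det_ne {n : ℕ} (A : Matrix (Fin n) (Fin n) ℝ)
    (hsym : A.IsSymm) (hA : ∀ i j, 0 ≤ A i j)
    (hirr : ∀ i j : Fin n, i ≠ j → ∃ k : ℕ, 1 ≤ k ∧ 0 < (A ^ k) i j)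
    (ρ : ℝ) (hρ : 0 < ρ) (p : Fin n → ℝ) (hp : ∀ i, 0 < p i)
    (hAp : A.mulVec p = ρ • p) (j : Fin n) :
    (ρ • (1 : Matrix {i : Fin n // i ≠ j} {i : Fin n // i ≠ j} ℝ) - delSub A j).det ≠ 0 := by
  intro hdet
  obtain ⟨v, hv, hv0⟩ := exists_mulVec_eq_zero_iff.2 hdet
  apply hv
  let w : Fin n → ℝ := fun k => if h : k = j then 0 else v ⟨k, h⟩
  have hwv : ∀ l : {i : Fin n // i ≠ j}, w l.1 = v l := fun l => by
    simp only [w, dif_neg l.2]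
  have hwj : w j = 0 := by simp [w]
  have := zero_of_ker A hsym hA hirr ρ hρ p hp hAp j w hwj (by
    intro k hk
    have h := congrFun hv0 ⟨k, hk⟩
    rw [sub_mulVec, smul_mulVec, one_mulVec] at h
    simp only [Pi.sub_apply, Pi.smul_apply, smul_eq_mul, Pi.zero_apply] at h
    have h2 : A.mulVec w k = (delSub A j).mulVec v ⟨k, hk⟩ := by
      simp only [mulVec, dotProduct]
      rw [sum_split j _ (by simp [hwj])]
      exact Finset.sum_congr rfl fun l _ => by rw [hwv]; rfl
    have h3 := hwv ⟨k, hk⟩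
    simp only at h3
    rw [h2, h3]; linarith)
  ext l
  rw [← hwv l, this]; rfl

lemma L_col {n : ℕ} (A : Matrix (Fin n) (Fin n) ℝ)
    (hsym : A.IsSymm) (hA : ∀ i j, 0 ≤ A i j)
    (hirr : ∀ i j : Fin n, i ≠ j → ∃ k : ℕ, 1 ≤ k ∧ 0 < (A ^ k) i j)
    (ρ : ℝ) (hρ : 0 < ρ) (p : Fin n → ℝ) (hp : ∀ i, 0 < p i)
    (hAp : A.mulVec p = ρ • p) (i j : Fin n) (hij : i ≠ j) :
    p j • (ρ • (1 : Matrix (Fin n) (Fin n) ℝ) - A).mulVec (fun k => Ybar A ρ j k i)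
      = p j • Pi.single i 1 - p i • Pi.single j 1 := by
  set y : Fin n → ℝ := fun k => Ybar A ρ j k i with hy
  set B := ρ • (1 : Matrix {i : Fin n // i ≠ j} {i : Fin n // i ≠ j} ℝ) - delSub A j with hB
  have hBB : B * B⁻¹ = 1 :=
    mul_nonsing_inv _ (isUnit_iff_ne_zero.2 (det_ne A hsym hA hirr ρ hρ p hp hAp j))
  have hyj : y j = 0 := by simp [hy, Ybar]
  have hyv : ∀ l : {i : Fin n // i ≠ j}, y l.1 = B⁻¹ l ⟨i, hij⟩ := fun l => by
    simp only [hy, Ybar, of_apply, dif_neg l.2, dif_neg hij, hB]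
  set z := (ρ • (1 : Matrix (Fin n) (Fin n) ℝ) - A).mulVec y with hz
  have hzk : ∀ k, k ≠ j → z k = if k = i then 1 else 0 := by
    intro k hk
    have h := congrFun (congrFun hBB ⟨k, hk⟩) ⟨i, hij⟩
    rw [one_apply, mul_apply] at h
    simp only [Subtype.mk.injEq] at h
    rw [← h, hz]
    simp only [mulVec, dotProduct]
    rw [sum_split j _ (by simp [hyj])]
    refine Finset.sum_congr rfl fun l _ => ?_
    rw [hyv]
    congr 1
    simp [hB, delSub, one_apply, Subtype.ext_iff]
  have hdot : ∑ k, p k * z k = 0 := by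
    have h := dot_L A hsym ρ p hAp y
    change p ⬝ᵥ z = 0
    rw [hz, sub_mulVec, smul_mulVec, one_mulVec, dotProduct_sub, h, dotProduct_smul, smul_eq_mul,
      sub_self]
  have hzj : p j * z j = - p i := by
    rw [← Finset.add_sum_erase _ _ (Finset.mem_univ j)] at hdot
    rw [Finset.sum_congr rfl (g := fun k => if k = i then p k else 0)
      (fun k hk => by rw [hzk k (Finset.ne_of_mem_erase hk)]; split_ifs <;> simp)] at hdot
    rw [Finset.sum_ite_eq' , if_pos (by simp [hij])] at hdot
    linarith
  ext k
  by_cases hk : k = j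
  · subst hk
    simp [hzj, Ne.symm hij]
  · simp [hzk k hk, Pi.single_apply, hk]

/-- `(ρI - A)(p_j Ȳ(j)^i + p_i Ȳ(i)^j) = 0`, and hence, when
`ker(ρI - A) = span{p}`, the vector `p_j Ȳ(j)^i + p_i Ȳ(i)^j` is a multiple of `p`. -/
theorem Ybar_column_combination_in_kernel
    {n : ℕ} (hn : 1 < n) (A : Matrix (Fin n) (Fin n) ℝ)
    (hsym : A.IsSymm) (hA : ∀ i j, 0 ≤ A i j)
    (hirr : ∀ i j : Fin n, i ≠ j → ∃ k : ℕ, 1 ≤ k ∧ 0 < (A ^ k) i j)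
    (ρ : ℝ) (hρ : 0 < ρ) (p : Fin n → ℝ) (hp : ∀ i, 0 < p i)
    (hAp : A.mulVec p = ρ • p) :
    ∀ i j : Fin n, i ≠ j →
      (ρ • (1 : Matrix (Fin n) (Fin n) ℝ) - A).mulVec
        (p j • (fun k => Ybar A ρ j k i) + p i • (fun k => Ybar A ρ i k j)) = 0 ∧
      ((∀ v : Fin n → ℝ, A.mulVec v = ρ • v → ∃ c : ℝ, v = c • p) →
        ∃ c : ℝ,
          (p j • (fun k => Ybar A ρ j k i) + p i • (fun k => Ybar A ρ i k j)) = c • p) := by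
  intro i j hij
  have h0 : (ρ • (1 : Matrix (Fin n) (Fin n) ℝ) - A).mulVec
        (p j • (fun k => Ybar A ρ j k i) + p i • (fun k => Ybar A ρ i k j)) = 0 := by
    rw [mulVec_add, mulVec_smul, mulVec_smul, L_col A hsym hA hirr ρ hρ p hp hAp i j hij,
      L_col A hsym hA hirr ρ hρ p hp hAp j i hij.symm]
    abel
  refine ⟨h0, fun hker => hker _ ?_⟩
  rw [sub_mulVec, smul_mulVec, one_mulVec, sub_eq_zero] at h0
  exact h0.symm
end

section
/- Let A be an n×n real symmetric matrix (n > 1) with nonnegative entries that is irreducible, ρ its Perron root, and p a strictly positive eigenvector with A p = ρ p and ker(ρI − A) = span{p}. Let p' = √n · p/‖p‖₂, P' = diag(p'), and L' = P'(ρI − A)P' (the Laplacian matrix of the graph G' with weighted adjacency matrix P' A P'). Then for all indices i ≠ j, the submatrices L'_ĵĵ and L'_îî are invertible and n^{-1} · ( p_i^{-1}((ρI − A_ĵĵ)^{-1} p_ĵ)_i + p_j^{-1}((ρI − A_îî)^{-1} p_î)_j ) = n^{-1} · ( ∑_{k ≠ j} ((L'_ĵĵ)^{-1})_{ik} + ∑_{k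 ≠ i} ((L'_îî)^{-1})_{jk} ); that is, the long walk distance in G coincides with the resistance distance in G'. -/
open Matrix

/-- `p` with its `j`-th entry deleted. -/
noncomputable def delVec {n : ℕ} (p : Fin n → ℝ) (j : Fin n) :
    {i : Fin n // i ≠ j} → ℝ :=
  fun k => p k

theorem lw_aux_sum {n : ℕ} (j : Fin n) (f : Fin n → ℝ) :
    ∑ k, f k = f j + ∑ k : {k : Fin n // k ≠ j}, f k := by
  rw [← Fintype.sum_subtype_add_sum_subtype (fun k => k = j) f]
  have h : f (default : {k : Fin n // k = j}) = f j :=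
    congrArg f (default : {k : Fin n // k = j}).2
  simp [h]

theorem lw_aux_mulVec {n : ℕ} (L : Matrix (Fin n) (Fin n) ℝ) (j : Fin n) (x : Fin n → ℝ)
    (hx : x j = 0) (k : {k : Fin n // k ≠ j}) :
    (L *ᵥ x) k = (delSub L j *ᵥ (delVec x j)) k := by
  simp only [Matrix.mulVec, dotProduct]
  rw [lw_aux_sum j, hx]
  simp [delSub, delVec]

theorem lw_aux_sum_zero {n : ℕ} (L : Matrix (Fin n) (Fin n) ℝ) (hs : L.IsSymm)
    (h1 : L *ᵥ (fun _ => 1) = 0) (x : Fin n → ℝ) : ∑ k, (L *ᵥ x) k = 0 := by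
  simp only [Matrix.mulVec, dotProduct]
  rw [Finset.sum_comm]
  apply Finset.sum_eq_zero
  intro m _
  rw [← Finset.sum_mul]
  have := congrFun h1 m
  simp only [Matrix.mulVec, dotProduct, mul_one, Pi.zero_apply] at this
  have h2 : ∑ k, L k m = 0 := by
    rw [← this]
    exact Finset.sum_congr rfl fun k _ => hs.apply m k
  rw [h2, zero_mul]

/-- extension by zero -/
noncomputable def lwExt {n : ℕ} (j : Fin n) (v : {k : Fin n // k ≠ j} → ℝ) : Fin n → ℝ :=
  fun k => if h : k ≠ j then v ⟨k, h⟩ else 0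

theorem lwExt_self {n : ℕ} (j : Fin n) (v : {k : Fin n // k ≠ j} → ℝ) : lwExt j v j = 0 := by
  simp [lwExt]

theorem lwExt_val {n : ℕ} (j : Fin n) (v : {k : Fin n // k ≠ j} → ℝ) (k : {k : Fin n // k ≠ j}) :
    lwExt j v k = v k := by
  simp [lwExt, k.2]

theorem delVec_lwExt {n : ℕ} (j : Fin n) (v : {k : Fin n // k ≠ j} → ℝ) :
    delVec (lwExt j v) j = v := by
  funext k
  exact lwExt_val j v k

theorem lw_aux_unit {n : ℕ} (L : Matrix (Fin n) (Fin n) ℝ) (hs : L.IsSymm)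
    (h1 : L *ᵥ (fun _ => 1) = 0)
    (hker : ∀ v : Fin n → ℝ, L *ᵥ v = 0 → ∃ c : ℝ, ∀ k, v k = c) (j : Fin n) :
    IsUnit (delSub L j).det := by
  rw [isUnit_iff_ne_zero]
  intro h0
  obtain ⟨v, hv, hv0⟩ := Matrix.exists_mulVec_eq_zero_iff.mpr h0
  have hk : ∀ k : {k : Fin n // k ≠ j}, (L *ᵥ lwExt j v) k = 0 := by
    intro k
    rw [lw_aux_mulVec L j _ (lwExt_self j v), delVec_lwExt, hv0]
    rfl
  have hz := lw_aux_sum_zero L hs h1 (lwExt j v)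
  rw [lw_aux_sum j, Finset.sum_eq_zero (fun k _ => hk k), add_zero] at hz
  obtain ⟨c, hc⟩ := hker (lwExt j v) (by
    funext k
    by_cases h : k = j
    · rw [h]; exact hz
    · exact hk ⟨k, h⟩)
  apply hv
  funext k
  rw [← lwExt_val j v k, hc, ← hc j, lwExt_self]
  rfl

theorem lw_aux_solve {n : ℕ} (L : Matrix (Fin n) (Fin n) ℝ) (hs : L.IsSymm)
    (h1 : L *ᵥ (fun _ => 1) = 0) (i j : Fin n) (hij : i ≠ j) (hu : IsUnit (delSub L j).det) :
    L *ᵥ lwExt j ((delSub L j)⁻¹ ⟨i, hij⟩) = Pi.single i 1 - Pi.single j 1 := by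
  have hsd : (delSub L j)ᵀ = delSub L j := by
    ext a b
    exact hs.apply _ _
  have hk : ∀ k : {k : Fin n // k ≠ j}, (L *ᵥ lwExt j ((delSub L j)⁻¹ ⟨i, hij⟩)) k
      = (Pi.single i 1 : Fin n → ℝ) k := by
    intro k
    rw [lw_aux_mulVec L j _ (lwExt_self j _), delVec_lwExt]
    have h2 : ((delSub L j)⁻¹ * delSub L j) ⟨i, hij⟩ k = (delSub L j *ᵥ (delSub L j)⁻¹ ⟨i, hij⟩) k := by
      rw [Matrix.mul_apply, Matrix.mulVec, dotProduct]
      refine Finset.sum_congr rfl fun m _ => ?_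
      rw [mul_comm]
      congr 1
      exact congrFun (congrFun hsd k) m
    rw [← h2, Matrix.nonsing_inv_mul _ hu, Matrix.one_apply, Pi.single_apply]
    simp only [Subtype.ext_iff, eq_comm]
  have hz := lw_aux_sum_zero L hs h1 (lwExt j ((delSub L j)⁻¹ ⟨i, hij⟩))
  have hsum : ∑ k : {k : Fin n // k ≠ j}, (Pi.single i 1 : Fin n → ℝ) k = 1 := by
    have := lw_aux_sum j (Pi.single i 1 : Fin n → ℝ)
    rw [Finset.sum_pi_single', Pi.single_apply, if_neg hij.symm] at this
    simpa using this.symm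
  rw [lw_aux_sum j, Finset.sum_congr rfl (fun k _ => hk k), hsum] at hz
  funext k
  by_cases h : k = j
  · subst h
    simp [Pi.single_apply, hij.symm]
    linarith
  · rw [hk ⟨k, h⟩]
    simp [Pi.single_apply, h]

theorem lw_aux_key {n : ℕ} (L : Matrix (Fin n) (Fin n) ℝ) (hs : L.IsSymm)
    (h1 : L *ᵥ (fun _ => 1) = 0)
    (hker : ∀ v : Fin n → ℝ, L *ᵥ v = 0 → ∃ c : ℝ, ∀ k, v k = c) (i j : Fin n) (hij : i ≠ j) :
    ∃ c : ℝ, ∀ w : Fin n → ℝ,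
      (∑ k : {k : Fin n // k ≠ j}, (delSub L j)⁻¹ ⟨i, hij⟩ k * w k) +
      (∑ k : {k : Fin n // k ≠ i}, (delSub L i)⁻¹ ⟨j, hij.symm⟩ k * w k) = c * ∑ k, w k := by
  have hx := lw_aux_solve L hs h1 i j hij (lw_aux_unit L hs h1 hker j)
  have hy := lw_aux_solve L hs h1 j i hij.symm (lw_aux_unit L hs h1 hker i)
  obtain ⟨c, hc⟩ := hker (lwExt j ((delSub L j)⁻¹ ⟨i, hij⟩) +
    lwExt i ((delSub L i)⁻¹ ⟨j, hij.symm⟩)) (by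
      rw [Matrix.mulVec_add, hx, hy]; abel)
  refine ⟨c, fun w => ?_⟩
  have e : ∀ (j : Fin n) (v : {k : Fin n // k ≠ j} → ℝ),
      ∑ k : {k : Fin n // k ≠ j}, v k * w k = ∑ k, lwExt j v k * w k := by
    intro j v
    rw [lw_aux_sum j, lwExt_self, zero_mul, zero_add]
    exact Finset.sum_congr rfl fun k _ => by rw [lwExt_val]
  rw [e, e, ← Finset.sum_add_distrib, Finset.mul_sum]
  refine Finset.sum_congr rfl fun k _ => ?_
  rw [← hc k, Pi.add_apply, add_mul]

theorem lw_aux_term {n : ℕ} (A : Matrix (Fin n) (Fin n) ℝ) (ρ s : ℝ) (hs0 : s ≠ 0)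
    (p : Fin n → ℝ) (hp : ∀ i, 0 < p i) (L : Matrix (Fin n) (Fin n) ℝ)
    (hL : ∀ a b, L a b = (s * p a) * (ρ • (1 : Matrix (Fin n) (Fin n) ℝ) - A) a b * (s * p b))
    (j : Fin n) (i : {k : Fin n // k ≠ j}) (hu : IsUnit (delSub L j).det) :
    (p i)⁻¹ * ((ρ • (1 : Matrix {k : Fin n // k ≠ j} {k : Fin n // k ≠ j} ℝ)
            - delSub A j)⁻¹.mulVec (delVec p j)) i
      = ∑ k : {k : Fin n // k ≠ j}, (delSub L j)⁻¹ i k * (s * p k) ^ 2 := by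
  set D : Matrix {k : Fin n // k ≠ j} {k : Fin n // k ≠ j} ℝ :=
    Matrix.diagonal (fun k => s * p k) with hD
  set E : Matrix {k : Fin n // k ≠ j} {k : Fin n // k ≠ j} ℝ :=
    Matrix.diagonal (fun k => (s * p k)⁻¹) with hE
  set B := ρ • (1 : Matrix {k : Fin n // k ≠ j} {k : Fin n // k ≠ j} ℝ) - delSub A j with hB
  have hne : ∀ k, s * p k ≠ 0 := fun k => mul_ne_zero hs0 (hp k).ne'
  have hDE : D * E = 1 := by
    rw [hD, hE, Matrix.diagonal_mul_diagonal, ← Matrix.diagonal_one]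
    congr 1
    funext k
    exact mul_inv_cancel₀ (hne k)
  have hED : E * D = 1 := mul_eq_one_comm.mp hDE
  have hLB : delSub L j = D * B * D := by
    ext a b
    rw [hD, Matrix.mul_diagonal, Matrix.diagonal_mul]
    simp only [delSub, Matrix.submatrix_apply, hL, hB, Matrix.sub_apply, Matrix.smul_apply,
      Matrix.one_apply, Subtype.ext_iff]
  have hBL : B = E * delSub L j * E := by
    rw [hLB]
    calc B = 1 * B * 1 := by simp
      _ = (E * D) * B * (D * E) := by rw [hED, hDE]
      _ = _ := by simp only [Matrix.mul_assoc]
  have hinv : B⁻¹ = D * (delSub L j)⁻¹ * D := by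
    apply Matrix.inv_eq_right_inv
    rw [hBL]
    calc E * delSub L j * E * (D * (delSub L j)⁻¹ * D)
        = E * (delSub L j * ((E * D) * ((delSub L j)⁻¹ * D))) := by
          simp only [Matrix.mul_assoc]
      _ = E * ((delSub L j * (delSub L j)⁻¹) * D) := by
          rw [hED, Matrix.one_mul, Matrix.mul_assoc]
      _ = 1 := by rw [Matrix.mul_nonsing_inv _ hu, Matrix.one_mul, hED]
  rw [hinv, Matrix.mulVec, dotProduct, Finset.mul_sum]
  refine Finset.sum_congr rfl fun k _ => ?_
  rw [hD, Matrix.mul_diagonal, Matrix.diagonal_mul, delVec]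
  have := (hp i).ne'
  field_simp

/-- the long walk distance in `G` coincides with the resistance distance in
the graph `G'` with weighted adjacency matrix `P'AP'`, where `p' = √n·p/‖p‖₂`,
`P' = diag(p')`, and `L' = P'(ρI - A)P'` is the Laplacian of `G'`. -/
theorem long_walk_distance_is_resistance_distance
    {n : ℕ} (hn : 1 < n) (A : Matrix (Fin n) (Fin n) ℝ)
    (hsym : A.IsSymm) (hA : ∀ i j, 0 ≤ A i j)
    (hirr : ∀ i j : Fin n, i ≠ j → ∃ k : ℕ, 1 ≤ k ∧ 0 < (A ^ k) i j)
    (ρ : ℝ) (hρ : 0 < ρ) (p : Fin n → ℝ) (hp : ∀ i, 0 < p i)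
    (hAp : A.mulVec p = ρ • p)
    (hker : ∀ v : Fin n → ℝ, A.mulVec v = ρ • v → ∃ c : ℝ, v = c • p)
    (p' : Fin n → ℝ)
    (hp' : p' = (Real.sqrt n / Real.sqrt (∑ i, p i ^ 2)) • p)
    (L' : Matrix (Fin n) (Fin n) ℝ)
    (hL' : L' = Matrix.diagonal p' * (ρ • (1 : Matrix (Fin n) (Fin n) ℝ) - A)
      * Matrix.diagonal p') :
    ∀ i j : Fin n, ∀ hij : i ≠ j,
      IsUnit (delSub L' j).det ∧ IsUnit (delSub L' i).det ∧
      (n : ℝ)⁻¹ *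
        ((p i)⁻¹ *
          ((ρ • (1 : Matrix {k : Fin n // k ≠ j} {k : Fin n // k ≠ j} ℝ)
            - delSub A j)⁻¹.mulVec (delVec p j)) ⟨i, hij⟩ +
         (p j)⁻¹ *
          ((ρ • (1 : Matrix {k : Fin n // k ≠ i} {k : Fin n // k ≠ i} ℝ)
            - delSub A i)⁻¹.mulVec (delVec p i)) ⟨j, hij.symm⟩) =
      (n : ℝ)⁻¹ *
        ((∑ k : {k : Fin n // k ≠ j}, (delSub L' j)⁻¹ ⟨i, hij⟩ k) +
         (∑ k : {k : Fin n // k ≠ i}, (delSub L' i)⁻¹ ⟨j, hij.symm⟩ k)) := by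
  intro i j hij
  have hn0 : (0 : ℝ) < n := by exact_mod_cast (by omega : 0 < n)
  have hsq : 0 < ∑ i, p i ^ 2 :=
    Finset.sum_pos (fun k _ => pow_pos (hp k) 2) ⟨i, Finset.mem_univ i⟩
  set s : ℝ := Real.sqrt n / Real.sqrt (∑ i, p i ^ 2) with hs
  have hspos : 0 < s := div_pos (Real.sqrt_pos.mpr hn0) (Real.sqrt_pos.mpr hsq)
  have hL : ∀ a b, L' a b
      = (s * p a) * (ρ • (1 : Matrix (Fin n) (Fin n) ℝ) - A) a b * (s * p b) := by
    intro a b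
    rw [hL', hp', Matrix.mul_diagonal, Matrix.diagonal_mul]
    rfl
  have hne : ∀ k, s * p k ≠ 0 := fun k => mul_ne_zero hspos.ne' (hp k).ne'
  have hmv : ∀ v : Fin n → ℝ, ∀ a, (L' *ᵥ v) a
      = (s ^ 2 * p a) * (ρ * (p a * v a) - (A *ᵥ (fun b => p b * v b)) a) := by
    intro v a
    have h3 : (ρ • (1 : Matrix (Fin n) (Fin n) ℝ) - A) *ᵥ (fun b => p b * v b)
        = ρ • (fun b => p b * v b) - A *ᵥ (fun b => p b * v b) := by
      rw [Matrix.sub_mulVec, Matrix.smul_mulVec, Matrix.one_mulVec]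
    have h4 := congrFun h3 a
    simp only [Pi.sub_apply, Pi.smul_apply, smul_eq_mul] at h4
    rw [← h4]
    simp only [Matrix.mulVec, dotProduct, hL]
    rw [Finset.mul_sum]
    refine Finset.sum_congr rfl fun b _ => ?_
    ring
  have hsymL : L'.IsSymm := by
    ext a b
    rw [Matrix.transpose_apply, hL, hL]
    simp only [Matrix.sub_apply, Matrix.smul_apply, Matrix.one_apply, hsym.apply a b,
      eq_comm (a := a) (b := b)]
    ring
  have h1 : L' *ᵥ (fun _ => 1) = 0 := by
    funext a
    rw [hmv]
    simp [hAp]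
  have hkerL : ∀ v : Fin n → ℝ, L' *ᵥ v = 0 → ∃ c : ℝ, ∀ k, v k = c := by
    intro v hv
    obtain ⟨c, hc⟩ := hker (fun b => p b * v b) (by
      funext a
      have h5 := congrFun hv a
      rw [hmv, Pi.zero_apply] at h5
      have h6 := (mul_eq_zero.mp h5).resolve_left
        (mul_ne_zero (pow_ne_zero 2 hspos.ne') (hp a).ne')
      simp only [Pi.smul_apply, smul_eq_mul]
      linarith)
    refine ⟨c, fun k => ?_⟩
    have h7 := congrFun hc k
    simp only [Pi.smul_apply, smul_eq_mul] at h7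
    exact mul_left_cancel₀ (hp k).ne' (by rw [h7, mul_comm])
  have huj := lw_aux_unit L' hsymL h1 hkerL j
  have hui := lw_aux_unit L' hsymL h1 hkerL i
  refine ⟨huj, hui, ?_⟩
  congr 1
  obtain ⟨c, hc⟩ := lw_aux_key L' hsymL h1 hkerL i j hij
  have e1 := lw_aux_term A ρ s hspos.ne' p hp L' hL j ⟨i, hij⟩ huj
  have e2 := lw_aux_term A ρ s hspos.ne' p hp L' hL i ⟨j, hij.symm⟩ hui
  have c1 := hc (fun k => (s * p k) ^ 2)
  have c2 := hc (fun _ => 1)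
  have hw : ∑ k, (s * p k) ^ 2 = n := by
    simp only [mul_pow]
    rw [← Finset.mul_sum, hs, div_pow, Real.sq_sqrt hn0.le, Real.sq_sqrt hsq.le]
    exact div_mul_cancel₀ _ hsq.ne'
  simp only [mul_one, Finset.sum_const, Finset.card_univ, Fintype.card_fin, nsmul_eq_mul] at c2
  rw [c2]
  refine Eq.trans (congrArg₂ (· + ·) e1 e2) ?_
  rw [← hw]
  exact c1
end
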